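/- arXiv:math/0604542 — 7 statements merged into one kernel-verified Lean document; each statement's English description precedes it below -/
import Mathlib

section
/- Let C be a compact closed category, i.e., a symmetric monoidal category in which every object has a dual (a rigid symmetric monoidal category). If C has finite products, then C has finite biproducts. -/
open CategoryTheory CategoryTheory.Limits CategoryTheory.MonoidalCategory

namespace CategoryTheory.RigidCategory

section Zero

variable {C : Type u} [Category.{v} C] [MonoidalCategory C] [RigidCategory C]

theorem isRightAdjoint_tensorRight (X : C) : (tensorRight X).IsRightAdjoint :=
  (tensorRightAdjunction (ᘁX) X).isRightAdjoint

theorem subsingleton_hom_tensor_left {T : C} (hT : ∀ X : C, Subsingleton (X ⟶ T)) (X Y : C) :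
    Subsingleton (X ⟶ T ⊗ Y) :=
  (tensorRightHomEquiv X (ᘁY) Y T).symm.subsingleton

theorem hasZeroObject [HasTerminal C] : HasZeroObject C := by
  let T : C := ⊤_ C
  refine IsZero.hasZeroObject (X := Tᘁ ⊗ T) ⟨fun X => ?_, fun X => ?_⟩
  · have : Unique (T ⟶ T ⊗ X) :=
      ((tensorRightHomEquiv T (ᘁX) X T).symm.trans (Equiv.ofUnique _ (T ⟶ T))).unique
    exact ⟨(tensorLeftHomEquiv T T (Tᘁ) X).unique⟩
  · exact ⟨((tensorLeftHomEquiv X (Tᘁ) ((Tᘁ)ᘁ) T).symm).unique⟩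

theorem zero_whiskerRight [HasTerminal C] [HasZeroMorphisms C] (X Y Z : C) :
    (0 : X ⟶ Y) ▷ Z = 0 := by
  have := subsingleton_hom_tensor_left (T := ⊤_ C) (fun _ => inferInstance) (X ⊗ Z) Z
  have h : (0 : X ⟶ Y) = (0 : X ⟶ ⊤_ C) ≫ 0 := by simp
  rw [h, comp_whiskerRight, Subsingleton.elim ((0 : X ⟶ ⊤_ C) ▷ Z) 0, zero_comp]

end Zero

section Trace

variable {C : Type u} [Category.{v} C] [MonoidalCategory C] [SymmetricCategory C]

/-- The map sending a generalized element `x` of `P` to the trace of `m (x, -)`. -/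
def traceMul {P P' : C} [ExactPairing P P'] (m : P ⊗ P ⟶ P) : P ⟶ 𝟙_ C :=
  (ρ_ P).inv ≫ P ◁ η_ P P' ≫ (α_ _ _ _).inv ≫ m ▷ P' ≫ (β_ P P').hom ≫ ε_ P P'

/-- The trace of an idempotent split by the tensor unit is the identity. -/
theorem trace_comp_eq_id {P P' : C} [ExactPairing P P'] (i : 𝟙_ C ⟶ P) (p : P ⟶ 𝟙_ C)
    (h : i ≫ p = 𝟙 _) :
    η_ P P' ≫ (p ≫ i) ▷ P' ≫ (β_ P P').hom ≫ ε_ P P' = 𝟙 _ := by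
  have hz : i ≫ (λ_ P).inv ≫ (η_ P P' ≫ p ▷ P' ≫ (λ_ P').hom) ▷ P ≫ ε_ P P' = i ≫ p := by
    have := ExactPairing.evaluation_coevaluation P P'
    calc
      _ = i ≫ (λ_ P).inv ≫ η_ P P' ▷ P ≫ (α_ _ _ _).hom ≫ (p ▷ (P' ⊗ P) ≫ 𝟙_ C ◁ ε_ P P') ≫
          (λ_ _).hom := by
        simp
      _ = i ≫ (λ_ P).inv ≫ (η_ P P' ▷ P ≫ (α_ _ _ _).hom ≫ P ◁ ε_ P P') ≫ p ▷ 𝟙_ C ≫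
          (λ_ _).hom := by
        rw [← whisker_exchange]; simp
      _ = i ≫ p := by
        rw [this]; simp [unitors_equal]
  rw [← h, ← hz]
  set a := η_ P P' ≫ p ▷ P' ≫ (λ_ P').hom with ha
  have hb : (β_ (𝟙_ C) P').hom = (λ_ P').hom ≫ (ρ_ P').inv := braiding_tensorUnit_left P'
  calc
    _ = (η_ P P' ≫ p ▷ P' ≫ (λ_ P').hom) ≫ (ρ_ P').inv ≫ P' ◁ i ≫ ε_ P P' := by
      simp only [comp_whiskerRight, Category.assoc]
      rw [BraidedCategory.braiding_naturality_left_assoc, hb]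
      simp
    _ = (ρ_ _).inv ≫ (a ▷ 𝟙_ C ≫ P' ◁ i) ≫ ε_ P P' := by
      rw [← ha]; simp
    _ = _ := by
      rw [← whisker_exchange]; simp [← unitors_inv_equal]

theorem comp_traceMul_eq_id {P P' : C} [ExactPairing P P'] (m : P ⊗ P ⟶ P)
    (i : 𝟙_ C ⟶ P) (p : P ⟶ 𝟙_ C) (h : i ≫ p = 𝟙 _) (hm : i ▷ P ≫ m = (λ_ P).hom ≫ p ≫ i) :
    i ≫ traceMul (P' := P') m = 𝟙 _ := by
  rw [← trace_comp_eq_id (P' := P') i p h]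
  calc
    _ = (ρ_ _).inv ≫ (i ▷ 𝟙_ C ≫ P ◁ η_ P P') ≫ (α_ _ _ _).inv ≫ m ▷ P' ≫
        (β_ P P').hom ≫ ε_ P P' := by
      simp [traceMul]
    _ = (ρ_ _).inv ≫ 𝟙_ C ◁ η_ P P' ≫ (α_ _ _ _).inv ≫ (i ▷ P ≫ m) ▷ P' ≫
        (β_ P P').hom ≫ ε_ P P' := by
      rw [← whisker_exchange]; simp
    _ = _ := by
      rw [hm]; simp [← unitors_inv_equal]

end Trace

section Biproducts

variable {C : Type u} [Category.{v} C] [MonoidalCategory C] [SymmetricCategory C]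
  [RigidCategory C] [HasTerminal C] [HasZeroMorphisms C]

/-- A power of the tensor unit carries a summation map to the tensor unit. -/
theorem exists_sum_map (J : Type w) [HasProduct fun _ : J => 𝟙_ C] :
    ∃ s : (∏ᶜ fun _ : J => 𝟙_ C) ⟶ 𝟙_ C, ∀ (j : J) (i : 𝟙_ C ⟶ ∏ᶜ fun _ : J => 𝟙_ C),
      i ≫ Pi.π _ j = 𝟙 _ → (∀ k, k ≠ j → i ≫ Pi.π _ k = 0) → i ≫ s = 𝟙 _ := by
  let P := ∏ᶜ fun _ : J => 𝟙_ C
  let p (j : J) : P ⟶ 𝟙_ C := Pi.π _ j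
  let m : P ⊗ P ⟶ P := Pi.lift fun j => p j ▷ P ≫ (λ_ P).hom ≫ p j
  have hmp (j : J) : m ≫ p j = p j ▷ P ≫ (λ_ P).hom ≫ p j := Pi.lift_π _ _
  refine ⟨traceMul (P' := Pᘁ) m, fun j i hj hk => comp_traceMul_eq_id m i (p j) hj ?_⟩
  refine Pi.hom_ext _ _ fun k => ?_
  change (i ▷ P ≫ m) ≫ p k = ((λ_ P).hom ≫ p j ≫ i) ≫ p k
  rw [Category.assoc, hmp, ← comp_whiskerRight_assoc]
  simp only [Category.assoc]
  by_cases h : k = j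
  · subst h
    rw [show i ≫ p k = 𝟙 _ from hj]
    simp
  · rw [show i ≫ p k = 0 from hk k h, zero_whiskerRight]
    simp

/-- Families of parallel morphisms have a sum, compatible with composition on both sides. -/
theorem exists_sum (J : Type w) [HasProduct fun _ : J => 𝟙_ C] :
    ∃ S : ∀ {A B : C}, (J → (A ⟶ B)) → (A ⟶ B),
      (∀ {A A' B : C} (g : A' ⟶ A) (f : J → (A ⟶ B)), g ≫ S f = S fun j => g ≫ f j) ∧
      (∀ {A B B' : C} (f : J → (A ⟶ B)) (g : B ⟶ B'), S f ≫ g = S fun j => f j ≫ g) ∧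
      ∀ {A B : C} (f : J → (A ⟶ B)) (j : J), (∀ k, k ≠ j → f k = 0) → S f = f j := by
  classical
  obtain ⟨s, hs⟩ := exists_sum_map (C := C) J
  let P := ∏ᶜ fun _ : J => 𝟙_ C
  let p (j : J) : P ⟶ 𝟙_ C := Pi.π _ j
  have (B : C) := isRightAdjoint_tensorRight B
  let hl (B : C) : IsLimit (Fan.mk (P ⊗ B) fun j => p j ▷ B) :=
    isLimitOfHasProductOfPreservesLimit (tensorRight B) fun _ : J => 𝟙_ C
  let l {A B : C} (f : J → (A ⟶ B)) : A ⟶ P ⊗ B :=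
    Fan.IsLimit.lift (hl B) fun j => f j ≫ (λ_ B).inv
  have hlp {A B : C} (f : J → (A ⟶ B)) (j : J) : l f ≫ p j ▷ B = f j ≫ (λ_ B).inv :=
    Fan.IsLimit.fac (hl B) _ j
  have hext {A B : C} {f g : A ⟶ P ⊗ B} (h : ∀ j, f ≫ p j ▷ B = g ≫ p j ▷ B) : f = g :=
    Fan.IsLimit.hom_ext (hl B) _ _ h
  refine ⟨fun {A B} f => l f ≫ s ▷ B ≫ (λ_ B).hom, fun {A A' B} g f => ?_,
    fun {A B B'} f g => ?_, fun {A B} f j hf => ?_⟩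
  · have : g ≫ l f = l fun j => g ≫ f j := hext fun j => by simp [hlp]
    change g ≫ l f ≫ s ▷ B ≫ (λ_ B).hom = (l fun j => g ≫ f j) ≫ s ▷ B ≫ (λ_ B).hom
    rw [← this, Category.assoc]
  · have : l f ≫ P ◁ g = l fun j => f j ≫ g := hext fun j => by
      rw [Category.assoc, whisker_exchange, reassoc_of% (hlp f j), hlp]
      simp
    change (l f ≫ s ▷ B ≫ (λ_ B).hom) ≫ g = (l fun j => f j ≫ g) ≫ s ▷ B' ≫ (λ_ B').hom
    rw [← this]
    simp only [Category.assoc]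
    rw [whisker_exchange_assoc]
    simp
  · let i : 𝟙_ C ⟶ P := Pi.lift fun k => if k = j then 𝟙 _ else 0
    have hij : i ≫ p j = 𝟙 _ := (Pi.lift_π _ _).trans (if_pos rfl)
    have hik (k : J) (hk : k ≠ j) : i ≫ p k = 0 := (Pi.lift_π _ _).trans (if_neg hk)
    have : l f = f j ≫ (λ_ B).inv ≫ i ▷ B := hext fun k => by
      rw [hlp]
      simp only [Category.assoc, ← comp_whiskerRight]
      by_cases hk : k = j
      · subst hk
        simp [hij]
      · simp [hik k hk, hf k hk, zero_whiskerRight]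
    change l f ≫ s ▷ B ≫ (λ_ B).hom = f j
    rw [this]
    simp only [Category.assoc, ← comp_whiskerRight_assoc]
    rw [hs j i hij hik]
    simp

theorem hasBiproduct {J : Type w} [HasProduct fun _ : J => 𝟙_ C] (F : J → C) [HasProduct F] :
    HasBiproduct F := by
  classical
  obtain ⟨S, comp_S, S_comp, S_eq⟩ := exists_sum (C := C) J
  let ι (j : J) : F j ⟶ ∏ᶜ F :=
    Pi.lift fun k => if h : j = k then eqToHom (congrArg F h) else 0
  have ι_π (j k : J) :
      ι j ≫ Pi.π F k = if h : j = k then eqToHom (congrArg F h) else 0 := Pi.lift_π _ _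
  have ι_π_self (j : J) : ι j ≫ Pi.π F j = 𝟙 _ := by simp [ι_π]
  have ι_π_ne {j k : J} (h : j ≠ k) : ι j ≫ Pi.π F k = 0 := by simp [ι_π, h]
  have total : S (fun j => Pi.π F j ≫ ι j) = 𝟙 _ := Pi.hom_ext _ _ fun k => by
    rw [S_comp, S_eq _ k fun j hj => by simp [ι_π_ne hj]]
    simp [ι_π_self]
  have uniq {X : C} (f : ∏ᶜ F ⟶ X) (g : ∀ j, F j ⟶ X) (h : ∀ j, ι j ≫ f = g j) :
      f = S fun j => Pi.π F j ≫ g j := by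
    rw [← Category.id_comp f, ← total, S_comp]
    simp [h]
  let b : Limits.Bicone F := { pt := ∏ᶜ F, π := Pi.π F, ι := ι, ι_π := ι_π }
  refine HasBiproduct.mk ⟨b, ⟨productIsProduct F, Cofan.IsColimit.mk b.toCocone
    (fun t => S fun j => Pi.π F j ≫ t.inj j) (fun t j => ?_) fun t f hf => ?_⟩⟩
  · change ι j ≫ S (fun k => Pi.π F k ≫ t.inj k) = t.inj j
    rw [comp_S, S_eq _ j fun k hk => by rw [← Category.assoc, ι_π_ne hk.symm, zero_comp],
      ← Category.assoc, ι_π_self, Category.id_comp]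
  · exact uniq f t.inj hf

end Biproducts

end CategoryTheory.RigidCategory

/-- If a compact closed category (symmetric monoidal with all objects dualizable,
i.e. rigid symmetric monoidal) has finite products, then it has finite biproducts. -/
theorem compactClosed_hasFiniteProducts_hasFiniteBiproducts
    {C : Type u} [Category.{v} C] [MonoidalCategory C] [SymmetricCategory C]
    [RigidCategory C] [HasFiniteProducts C] :
    ∃ _ : HasZeroMorphisms C, HasFiniteBiproducts C := by
  have : HasZeroObject C := RigidCategory.hasZeroObject
  let _ : HasZeroMorphisms C := HasZeroObject.zeroMorphismsOfZeroObject
  exact ⟨inferInstance, ⟨fun _ => ⟨fun F => RigidCategory.hasBiproduct F⟩⟩⟩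
end

section
/- Let C be a compact closed category, i.e., a symmetric monoidal category in which every object has a dual (a rigid symmetric monoidal category). If C has finite coproducts, then C has finite biproducts. -/
open CategoryTheory CategoryTheory.Limits CategoryTheory.MonoidalCategory

section Powers

variable {C : Type*} [Category* C]

/-- If `J`-indexed powers of objects are given by a functor preserving the coproduct of a
family `f : J → C`, then this coproduct is a biproduct. -/
theorem hasBiproduct_of_preservesColimit_power [HasZeroMorphisms C] {J : Type*} (f : J → C)
    [HasCoproduct f] (D : C ⥤ C) [PreservesColimit (Discrete.functor f) D]
    (p : ∀ (_ : J) (M : C), D.obj M ⟶ M)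
    (p_nat : ∀ (j : J) {X Y : C} (g : X ⟶ Y), D.map g ≫ p j Y = p j X ≫ g)
    (hp : ∀ M, IsLimit (Fan.mk (D.obj M) fun j => p j M)) :
    HasBiproduct f := by
  classical
  have hD := isColimitOfHasCoproductOfPreservesColimit D f
  let π (j : J) : ∐ f ⟶ f j := Sigma.desc fun i => if h : i = j then eqToHom (by rw [h]) else 0
  have ι_π (i j : J) :
      Sigma.ι f i ≫ π j = if h : i = j then eqToHom (by rw [h]) else 0 := by simp [π]
  let lift {Z M : C} (g : J → (Z ⟶ M)) : Z ⟶ D.obj M := Fan.IsLimit.lift (hp M) g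
  have lift_p {Z M : C} (g : J → (Z ⟶ M)) (j : J) : lift g ≫ p j M = g j :=
    Fan.IsLimit.fac (hp M) g j
  have power_ext {Z M : C} {g h : Z ⟶ D.obj M}
      (w : ∀ j, g ≫ p j M = h ≫ p j M) : g = h :=
    Fan.IsLimit.hom_ext (hp M) _ _ w
  let s : D.obj (∐ f) ⟶ ∐ f :=
    Cofan.IsColimit.desc hD fun j => p j (f j) ≫ Sigma.ι f j
  have map_ι_s (j : J) : D.map (Sigma.ι f j) ≫ s = p j (f j) ≫ Sigma.ι f j :=
    Cofan.IsColimit.fac hD _ j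
  have s_π (j : J) : s ≫ π j = p j (∐ f) ≫ π j := by
    refine Cofan.IsColimit.hom_ext hD _ _ fun i => ?_
    change D.map (Sigma.ι f i) ≫ s ≫ π j = D.map (Sigma.ι f i) ≫ p j (∐ f) ≫ π j
    rw [reassoc_of% map_ι_s, reassoc_of% p_nat, ι_π]
    split_ifs with h
    · subst h; rfl
    · simp
  have lift_s : lift (fun j => π j ≫ Sigma.ι f j) ≫ s = 𝟙 (∐ f) := by
    refine Sigma.hom_ext _ _ fun i => ?_
    have h : Sigma.ι f i ≫ lift (fun j => π j ≫ Sigma.ι f j) =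
        lift (Pi.single i (𝟙 (f i))) ≫ D.map (Sigma.ι f i) := by
      refine power_ext fun j => ?_
      rw [Category.assoc, Category.assoc, lift_p, p_nat, reassoc_of% lift_p, reassoc_of% ι_π]
      split_ifs with h
      · subst h; simp
      · simp [Pi.single_eq_of_ne' h]
    rw [reassoc_of% h, map_ι_s, reassoc_of% lift_p]
    simp
  let b : Bicone f := { pt := ∐ f, π := π, ι := Sigma.ι f, ι_π := ι_π }
  refine ⟨⟨b, ?_, ?_⟩⟩
  · refine Fan.IsLimit.mk _ (fun t => lift (fun j => t.proj j ≫ Sigma.ι f j) ≫ s) ?_ ?_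
    · intro t j
      change (lift _ ≫ s) ≫ π j = _
      rw [Category.assoc, s_π, reassoc_of% lift_p, Category.assoc, ι_π]
      simp
    · intro t (m : t.pt ⟶ ∐ f) (hm : ∀ j, m ≫ π j = t.proj j)
      have h : m ≫ lift (fun j => π j ≫ Sigma.ι f j) =
          lift (fun j => t.proj j ≫ Sigma.ι f j) :=
        power_ext fun j => by rw [Category.assoc, lift_p, lift_p, reassoc_of% hm]
      change m = lift (fun j => t.proj j ≫ Sigma.ι f j) ≫ s
      rw [← h, Category.assoc, lift_s, Category.comp_id]
  · exact coproductIsCoproduct f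

end Powers

section Rigid

variable {C : Type*} [Category* C] [MonoidalCategory C]

instance tensorLeft_isLeftAdjoint_of_hasLeftDual (X : C) [HasLeftDual X] :
    (tensorLeft X).IsLeftAdjoint :=
  (tensorLeftAdjunction (ᘁX) X).isLeftAdjoint

instance tensorRight_isLeftAdjoint_of_hasRightDual (X : C) [HasRightDual X] :
    (tensorRight X).IsLeftAdjoint :=
  (tensorRightAdjunction X Xᘁ).isLeftAdjoint

theorem RigidCategory.hasZeroObject [RigidCategory C] [HasInitial C] : HasZeroObject C := by
  have hr (Z : C) : IsInitial ((⊥_ C) ⊗ Z) := initialIsInitial.isInitialObj (tensorRight Z) _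
  have hl : IsInitial ((ᘁ(⊥_ C)) ⊗ ⊥_ C) :=
    initialIsInitial.isInitialObj (tensorLeft _) _
  refine ⟨(ᘁ(⊥_ C)) ⊗ ⊥_ C, fun Y => ⟨⟨⟨hl.to Y⟩, fun _ => hl.hom_ext _ _⟩⟩, fun Z => ?_⟩
  let e := tensorLeftHomEquiv Z (ᘁ(⊥_ C) : C) (⊥_ C) (⊥_ C)
  exact ⟨⟨⟨e ((hr Z).to _)⟩, fun _ => e.symm.injective ((hr Z).hom_ext _ _)⟩⟩

section

variable {J : Type*} [HasCoproduct fun _ : J => 𝟙_ C] [HasLeftDual (∐ fun _ : J => 𝟙_ C)]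

/-- The `j`-th projection from the `J`-indexed power of `M`, realized as the tensor product
of `M` with the left dual of the `J`-indexed copower of the unit. -/
noncomputable def powerProj (j : J) (M : C) : (ᘁ(∐ fun _ : J => 𝟙_ C)) ⊗ M ⟶ M :=
  (λ_ _).inv ≫ Sigma.ι (fun _ : J => 𝟙_ C) j ▷ _ ≫
    (tensorLeftAdjunction (ᘁ(∐ fun _ : J => 𝟙_ C)) (∐ fun _ : J => 𝟙_ C)).counit.app M

theorem powerProj_naturality (j : J) {X Y : C} (g : X ⟶ Y) :
    (ᘁ(∐ fun _ : J => 𝟙_ C)) ◁ g ≫ powerProj j Y = powerProj j X ≫ g := by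
  have h := (tensorLeftAdjunction (ᘁ(∐ fun _ : J => 𝟙_ C))
    (∐ fun _ : J => 𝟙_ C)).counit_naturality g
  dsimp only [curriedTensor_obj_obj, curriedTensor_obj_map] at h
  simp only [powerProj, Category.assoc, ← h, leftUnitor_inv_naturality_assoc,
    whisker_exchange_assoc]

theorem comp_powerProj (j : J) {Z M : C} (g : Z ⟶ (ᘁ(∐ fun _ : J => 𝟙_ C)) ⊗ M) :
    g ≫ powerProj j M = (λ_ Z).inv ≫ Sigma.ι (fun _ : J => 𝟙_ C) j ▷ Z ≫
      ((tensorLeftAdjunction (ᘁ(∐ fun _ : J => 𝟙_ C)) (∐ fun _ : J => 𝟙_ C)).homEquiv Z M).symm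
        g := by
  rw [Adjunction.homEquiv_counit]
  simp only [powerProj, leftUnitor_inv_naturality_assoc, whisker_exchange_assoc,
    curriedTensor_obj_map]

/-- If tensoring on the right preserves copowers of the unit, then tensoring with the left dual
of a copower of the unit computes powers. -/
noncomputable def isLimitPowerProj
    [∀ Z : C, PreservesColimit (Discrete.functor fun _ : J => 𝟙_ C) (tensorRight Z)] (M : C) :
    IsLimit (Fan.mk ((ᘁ(∐ fun _ : J => 𝟙_ C)) ⊗ M) fun j => powerProj j M) :=
  let e (Z : C) :=
    (tensorLeftAdjunction (ᘁ(∐ fun _ : J => 𝟙_ C)) (∐ fun _ : J => 𝟙_ C)).homEquiv Z M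
  let hZ (Z : C) := isColimitOfHasCoproductOfPreservesColimit (tensorRight Z) fun _ : J => 𝟙_ C
  Fan.IsLimit.mk _
    (fun t => e t.pt (Cofan.IsColimit.desc (hZ t.pt) fun j => (λ_ t.pt).hom ≫ t.proj j))
    (fun t j => by
      refine (comp_powerProj j _).trans ?_
      rw [Equiv.symm_apply_apply, Iso.inv_comp_eq]
      exact Cofan.IsColimit.fac (hZ t.pt) _ j)
    (fun t m hm => by
      rw [← Equiv.symm_apply_eq]
      refine Cofan.IsColimit.hom_ext (hZ t.pt) _ _ fun j => ?_
      refine Eq.trans ?_ (Cofan.IsColimit.fac (hZ t.pt) _ j).symm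
      rw [← Iso.inv_comp_eq]
      exact (comp_powerProj j m).symm.trans (hm j))

end

end Rigid

/-- If a compact closed category (symmetric monoidal with all objects dualizable,
i.e. rigid symmetric monoidal) has finite coproducts, then it has finite biproducts. -/
theorem compactClosed_hasFiniteCoproducts_hasFiniteBiproducts
    {C : Type u} [Category.{v} C] [MonoidalCategory C] [SymmetricCategory C]
    [RigidCategory C] [HasFiniteCoproducts C] :
    ∃ _ : HasZeroMorphisms C, HasFiniteBiproducts C := by
  have := RigidCategory.hasZeroObject (C := C)
  let _ : HasZeroMorphisms C := HasZeroObject.zeroMorphismsOfZeroObject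
  refine ⟨inferInstance, ⟨fun n => ⟨fun f => ?_⟩⟩⟩
  exact hasBiproduct_of_preservesColimit_power f (tensorLeft (ᘁ(∐ fun _ : Fin n => 𝟙_ C)))
    powerProj powerProj_naturality isLimitPowerProj
end

section
/- Let C be a monoidal category with finite products and finite coproducts, such that for every object A of C the functor A ⊗ − preserves finite products and the functor − ⊗ A preserves finite coproducts. Then C has finite biproducts. -/
open CategoryTheory CategoryTheory.Limits CategoryTheory.MonoidalCategory

section

variable {C : Type u} [Category.{v} C] [MonoidalCategory C]
  [HasFiniteProducts C] [HasFiniteCoproducts C]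
  [∀ A : C, PreservesFiniteProducts (tensorLeft A)]
  [∀ A : C, PreservesFiniteCoproducts (tensorRight A)]

/-- The object `⊥ ⊗ ⊤` is both initial and terminal. -/
theorem hasZeroObject_of_tensor_preserves : HasZeroObject C := by
  have hT : IsTerminal ((⊥_ C) ⊗ (⊤_ C)) :=
    terminalIsTerminal.isTerminalObj (tensorLeft (⊥_ C)) _
  have hI : IsInitial ((⊥_ C) ⊗ (⊤_ C)) :=
    initialIsInitial.isInitialObj (tensorRight (⊤_ C)) _
  exact ⟨_, fun Y => ⟨⟨⟨hI.to Y⟩, fun _ => hI.hom_ext _ _⟩⟩,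
    fun Y => ⟨⟨⟨hT.from Y⟩, fun _ => hT.hom_ext _ _⟩⟩⟩

variable [HasZeroObject C] [HasZeroMorphisms C]

theorem hasBiproduct_of_tensor_preserves {J : Type} [Finite J] (F : J → C) :
    HasBiproduct F := by
  classical
  let I : J → C := fun _ => 𝟙_ C
  let δ (i j : J) : F i ⟶ F j := if h : i = j then eqToHom (congrArg F h) else 0
  let q (j : J) : ∐ F ⟶ F j := Sigma.desc fun i => δ i j
  have ι_q (i j : J) : Sigma.ι F i ≫ q j = δ i j := by simp [q]
  have hL := isLimitOfHasProductOfPreservesLimit (tensorLeft (∐ F)) I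
  have hR := isColimitOfHasCoproductOfPreservesColimit (tensorRight (∏ᶜ I)) F
  let t : (∐ F) ⊗ (∏ᶜ I) ⟶ ∐ F :=
    Cofan.IsColimit.desc hR fun i => F i ◁ Pi.π I i ≫ (ρ_ (F i)).hom ≫ Sigma.ι F i
  have ι_t (i : J) : Sigma.ι F i ▷ (∏ᶜ I) ≫ t =
      F i ◁ Pi.π I i ≫ (ρ_ (F i)).hom ≫ Sigma.ι F i := Cofan.IsColimit.fac hR _ i
  let l {X : C} (s : ∀ j, X ⟶ F j) : X ⟶ (∐ F) ⊗ (∏ᶜ I) :=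
    Fan.IsLimit.lift hL fun j => s j ≫ Sigma.ι F j ≫ (ρ_ (∐ F)).inv
  have l_π {X : C} (s : ∀ j, X ⟶ F j) (j : J) : l s ≫ (∐ F) ◁ Pi.π I j =
      s j ≫ Sigma.ι F j ≫ (ρ_ (∐ F)).inv := Fan.IsLimit.fac hL _ j
  have t_q (j : J) : t ≫ q j = (∐ F) ◁ Pi.π I j ≫ (ρ_ (∐ F)).hom ≫ q j := by
    refine Cofan.IsColimit.hom_ext hR _ _ fun i => ?_
    change Sigma.ι F i ▷ (∏ᶜ I) ≫ _ = Sigma.ι F i ▷ (∏ᶜ I) ≫ _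
    rw [reassoc_of% (ι_t i), ← whisker_exchange_assoc, rightUnitor_naturality_assoc, ι_q]
    by_cases h : i = j
    · subst h; rfl
    · simp [δ, h]
  have l_t_q {X : C} (s : ∀ j, X ⟶ F j) (j : J) : (l s ≫ t) ≫ q j = s j := by
    rw [Category.assoc, t_q, reassoc_of% (l_π s j)]
    simp [ι_q, δ]
  have l_q_t : l q ≫ t = 𝟙 _ := by
    refine Sigma.hom_ext _ _ fun i => ?_
    let e : 𝟙_ C ⟶ ∏ᶜ I := Pi.lift fun j => if i = j then 𝟙 _ else 0
    have key : Sigma.ι F i ≫ l q = (ρ_ (F i)).inv ≫ F i ◁ e ≫ Sigma.ι F i ▷ (∏ᶜ I) := by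
      refine Fan.IsLimit.hom_ext hL _ _ fun j => ?_
      change _ ≫ (∐ F) ◁ Pi.π I j = _ ≫ (∐ F) ◁ Pi.π I j
      have he : F i ◁ e ≫ F i ◁ Pi.π I j = F i ◁ (if i = j then 𝟙 _ else 0) := by
        rw [← whiskerLeft_comp]; simp [e]
      simp only [Category.assoc, l_π]
      rw [← whisker_exchange, reassoc_of% he, reassoc_of% (ι_q i j)]
      by_cases h : i = j
      · subst h; simp [δ, I]
      · have h0 : F i ◁ (0 : 𝟙_ C ⟶ 𝟙_ C) = 0 := (tensorLeft (F i)).map_zero _ _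
        simp [δ, h, I, h0]
    have he : F i ◁ e ≫ F i ◁ Pi.π I i = 𝟙 _ := by
      rw [← whiskerLeft_comp]; simp [e, I]
    rw [reassoc_of% key, ι_t, reassoc_of% he]
    simp
  have uniq {X : C} (s : ∀ j, X ⟶ F j) (m : X ⟶ ∐ F) (hm : ∀ j, m ≫ q j = s j) :
      m = l s ≫ t := by
    have hm' : m ≫ l q = l s := by
      refine Fan.IsLimit.hom_ext hL _ _ fun j => ?_
      change _ ≫ (∐ F) ◁ Pi.π I j = _ ≫ (∐ F) ◁ Pi.π I j
      rw [Category.assoc, l_π, l_π, reassoc_of% (hm j)]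
    rw [← hm', Category.assoc, l_q_t, Category.comp_id]
  let b : Bicone F :=
    { pt := ∐ F
      π := q
      ι := Sigma.ι F
      ι_π := ι_q }
  exact HasBiproduct.mk ⟨b, Fan.IsLimit.mk b.toCone (fun s => l s.proj ≫ t)
    (fun s j => l_t_q s.proj j) (fun s m hm => uniq s.proj m hm), coproductIsCoproduct F⟩

end

/-- A monoidal category with finite products and coproducts in which `A ⊗ -`
preserves finite products and `- ⊗ A` preserves finite coproducts (for every
object `A`) has finite biproducts. -/
theorem monoidal_distrib_hasFiniteBiproducts
    {C : Type u} [Category.{v} C] [MonoidalCategory C]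
    [HasFiniteProducts C] [HasFiniteCoproducts C]
    [∀ A : C, PreservesFiniteProducts (tensorLeft A)]
    [∀ A : C, PreservesFiniteCoproducts (tensorRight A)] :
    ∃ _ : HasZeroMorphisms C, HasFiniteBiproducts C := by
  have := hasZeroObject_of_tensor_preserves (C := C)
  let _ : HasZeroMorphisms C := HasZeroObject.zeroMorphismsOfZeroObject
  exact ⟨inferInstance, ⟨fun _ => ⟨fun F => hasBiproduct_of_tensor_preserves F⟩⟩⟩
end

section
/- Let C be a monoidal category with an initial object 0 and a terminal object 1, such that the functor 0 ⊗ − preserves terminal objects and the functor − ⊗ 1 preserves initial objects. Then the unique morphism 0 → 1 is an isomorphism; in particular C has a zero object. -/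
open CategoryTheory CategoryTheory.Limits CategoryTheory.MonoidalCategory

/-- If `C` is a monoidal category with an initial object `0` and terminal object `1`,
such that `0 ⊗ -` preserves terminal objects and `- ⊗ 1` preserves initial objects,
then the unique morphism `0 ⟶ 1` is an isomorphism; in particular `C` has a zero object. -/
theorem monoidal_initial_terminal_isIso_and_hasZeroObject
    {C : Type u} [Category.{v} C] [MonoidalCategory C]
    [HasInitial C] [HasTerminal C]
    [PreservesLimit (Functor.empty.{0} C) (tensorLeft (⊥_ C))]
    [PreservesColimit (Functor.empty.{0} C) (tensorRight (⊤_ C))] :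
    IsIso (initial.to (⊤_ C)) ∧ HasZeroObject C := by
  have hi : IsInitial ((⊥_ C) ⊗ (⊤_ C)) :=
    initialIsInitial.isInitialObj (tensorRight (⊤_ C)) (⊥_ C)
  have ht : IsTerminal ((⊥_ C) ⊗ (⊤_ C)) :=
    terminalIsTerminal.isTerminalObj (tensorLeft (⊥_ C)) (⊤_ C)
  let e : (⊥_ C) ≅ (⊤_ C) :=
    initialIsInitial.uniqueUpToIso hi ≪≫ ht.uniqueUpToIso terminalIsTerminal
  refine ⟨?_, ⟨_, ⟨fun Y => ⟨⟨hi.to Y⟩, fun _ => hi.hom_ext _ _⟩,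
    fun Y => ⟨⟨ht.from Y⟩, fun _ => ht.hom_ext _ _⟩⟩⟩⟩
  rw [initialIsInitial.hom_ext (initial.to (⊤_ C)) e.hom]
  infer_instance
end

section
/- Let C be a monoidal category with finite products and finite coproducts, such that for every object A the functor A ⊗ − preserves finite products and the functor − ⊗ A preserves finite coproducts. Then for all objects A₁, A₂, B₁, B₂ of C, the canonical morphism [i₁ × i₁, i₂ × i₂] : ((A₁ ⊗ B₁) × (A₁ ⊗ B₂)) + ((A₂ ⊗ B₁) × (A₂ ⊗ B₂)) → ((A₁ ⊗ B₁) + (A₂ ⊗ B₁)) × ((A₁ ⊗ B₂) + (A₂ ⊗ B₂)) is an isomorphism. -/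
open CategoryTheory CategoryTheory.Limits CategoryTheory.MonoidalCategory

/-- In a monoidal category with finite products and coproducts where `A ⊗ -`
preserves finite products and `- ⊗ A` preserves finite coproducts, the canonical
map `[i₁ × i₁, i₂ × i₂] : ((A₁⊗B₁) ⨯ (A₁⊗B₂)) ⨿ ((A₂⊗B₁) ⨯ (A₂⊗B₂)) ⟶
((A₁⊗B₁) ⨿ (A₂⊗B₁)) ⨯ ((A₁⊗B₂) ⨿ (A₂⊗B₂))` is an isomorphism. -/
theorem monoidal_distrib_canonical_iso
    {C : Type u} [Category.{v} C] [MonoidalCategory C]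
    [HasFiniteProducts C] [HasFiniteCoproducts C]
    [∀ A : C, PreservesFiniteProducts (tensorLeft A)]
    [∀ A : C, PreservesFiniteCoproducts (tensorRight A)]
    (A₁ A₂ B₁ B₂ : C) :
    IsIso (coprod.desc
      (prod.map (coprod.inl : A₁ ⊗ B₁ ⟶ (A₁ ⊗ B₁) ⨿ (A₂ ⊗ B₁))
        (coprod.inl : A₁ ⊗ B₂ ⟶ (A₁ ⊗ B₂) ⨿ (A₂ ⊗ B₂)))
      (prod.map (coprod.inr : A₂ ⊗ B₁ ⟶ (A₁ ⊗ B₁) ⨿ (A₂ ⊗ B₁))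
        (coprod.inr : A₂ ⊗ B₂ ⟶ (A₁ ⊗ B₂) ⨿ (A₂ ⊗ B₂))) :
      ((A₁ ⊗ B₁) ⨯ (A₁ ⊗ B₂)) ⨿ ((A₂ ⊗ B₁) ⨯ (A₂ ⊗ B₂)) ⟶
      ((A₁ ⊗ B₁) ⨿ (A₂ ⊗ B₁)) ⨯ ((A₁ ⊗ B₂) ⨿ (A₂ ⊗ B₂))) := by
  let P (A : C) : A ⊗ (B₁ ⨯ B₂) ⟶ (A ⊗ B₁) ⨯ (A ⊗ B₂) := prod.lift (A ◁ prod.fst) (A ◁ prod.snd)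
  let Q (B : C) : (A₁ ⊗ B) ⨿ (A₂ ⊗ B) ⟶ (A₁ ⨿ A₂) ⊗ B :=
    coprod.desc (coprod.inl ▷ B) (coprod.inr ▷ B)
  have isIso_P (A : C) : IsIso (P A) :=
    inferInstanceAs (IsIso (prodComparison (tensorLeft A) B₁ B₂))
  have isIso_Q (B : C) : IsIso (Q B) :=
    inferInstanceAs (IsIso (coprodComparison (tensorRight B) A₁ A₂))
  have square :
      coprod.map (P A₁) (P A₂) ≫
        coprod.desc (prod.map coprod.inl coprod.inl) (prod.map coprod.inr coprod.inr) ≫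
        prod.map (Q B₁) (Q B₂) =
      Q (B₁ ⨯ B₂) ≫ P (A₁ ⨿ A₂) := by
    apply coprod.hom_ext <;> apply prod.hom_ext <;>
      simp [P, Q, whisker_exchange, coprod.inl_desc, coprod.inr_desc, prod.lift_fst, prod.lift_snd]
  have isIso_comp : IsIso (Q (B₁ ⨯ B₂) ≫ P (A₁ ⨿ A₂)) := inferInstance
  rw [← square] at isIso_comp
  have isIso_right := @IsIso.of_isIso_comp_left _ _ _ _ _ (coprod.map (P A₁) (P A₂)) _ _ isIso_comp
  exact @IsIso.of_isIso_comp_right _ _ _ _ _ _ (prod.map (Q B₁) (Q B₂)) _ isIso_right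
end

section
/- Let C be a monoidal category with finite products and finite coproducts, such that for every object A the functor A ⊗ − preserves finite products and the functor − ⊗ A preserves finite coproducts. Then for all objects A, B of C, the canonical morphism t_{A,B} = [i₁ × i₁, i₂ × i₂] : (A × A) + (B × B) → (A + B) × (A + B) is an isomorphism. -/
open CategoryTheory CategoryTheory.Limits CategoryTheory.MonoidalCategory

section

variable {C : Type*} [Category* C] [MonoidalCategory C] [HasFiniteProducts C]

/-- The canonical map `X ⊗ (𝟙_ C ⨯ 𝟙_ C) ⟶ X ⨯ X`. -/
noncomputable def tensorUnitProdToProd (X : C) : X ⊗ (𝟙_ C ⨯ 𝟙_ C) ⟶ X ⨯ X :=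
  prodComparison (tensorLeft X) (𝟙_ C) (𝟙_ C) ≫ prod.map (ρ_ X).hom (ρ_ X).hom

instance isIso_tensorUnitProdToProd (X : C) [PreservesFiniteProducts (tensorLeft X)] :
    IsIso (tensorUnitProdToProd X) := by
  unfold tensorUnitProdToProd
  infer_instance

theorem tensorUnitProdToProd_naturality {X Y : C} (f : X ⟶ Y) :
    f ▷ (𝟙_ C ⨯ 𝟙_ C) ≫ tensorUnitProdToProd Y = tensorUnitProdToProd X ≫ prod.map f f := by
  ext <;> simp [tensorUnitProdToProd, prodComparison, ← whisker_exchange_assoc]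

end

/-- In a monoidal category with finite products and coproducts where `A ⊗ -`
preserves finite products and `- ⊗ A` preserves finite coproducts, the canonical
map `t_{A,B} = [i₁ × i₁, i₂ × i₂] : (A ⨯ A) ⨿ (B ⨯ B) ⟶ (A ⨿ B) ⨯ (A ⨿ B)`
is an isomorphism. -/
theorem monoidal_distrib_t_iso
    {C : Type u} [Category.{v} C] [MonoidalCategory C]
    [HasFiniteProducts C] [HasFiniteCoproducts C]
    [∀ A : C, PreservesFiniteProducts (tensorLeft A)]
    [∀ A : C, PreservesFiniteCoproducts (tensorRight A)]
    (A B : C) :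
    IsIso (coprod.desc
      (prod.map (coprod.inl : A ⟶ A ⨿ B) (coprod.inl : A ⟶ A ⨿ B))
      (prod.map (coprod.inr : B ⟶ A ⨿ B) (coprod.inr : B ⟶ A ⨿ B)) :
      (A ⨯ A) ⨿ (B ⨯ B) ⟶ (A ⨿ B) ⨯ (A ⨿ B)) := by
  have h : coprod.map (tensorUnitProdToProd A) (tensorUnitProdToProd B) ≫
      coprod.desc (prod.map (coprod.inl : A ⟶ A ⨿ B) (coprod.inl : A ⟶ A ⨿ B))
        (prod.map (coprod.inr : B ⟶ A ⨿ B) (coprod.inr : B ⟶ A ⨿ B)) =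
      coprodComparison (tensorRight (𝟙_ C ⨯ 𝟙_ C)) A B ≫ tensorUnitProdToProd (A ⨿ B) := by
    apply coprod.hom_ext <;> simp [coprodComparison, tensorUnitProdToProd_naturality]
  have : IsIso (coprod.map (tensorUnitProdToProd A) (tensorUnitProdToProd B) ≫
      coprod.desc (prod.map (coprod.inl : A ⟶ A ⨿ B) (coprod.inl : A ⟶ A ⨿ B))
        (prod.map (coprod.inr : B ⟶ A ⨿ B) (coprod.inr : B ⟶ A ⨿ B))) := by
    rw [h]
    infer_instance
  exact IsIso.of_isIso_comp_left
    (coprod.map (tensorUnitProdToProd A) (tensorUnitProdToProd B)) _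
end

section
/- Let C be a category with finite products and finite coproducts, equipped with a bifunctor ⊗ : C × C → C and an object I together with a natural isomorphism A ⊗ I ≅ A (a right unit), such that for every object A the functor A ⊗ − preserves finite products and the functor − ⊗ A preserves finite coproducts. Then C has finite biproducts. -/
open CategoryTheory CategoryTheory.Limits

namespace CategoryTheory.Limits

/-- If `T.obj ⊥` preserves the terminal object and `T.flip.obj ⊤` the initial one, then
`⊥ ⊗ ⊤` is a zero object. -/
theorem hasZeroObject_of_bifunctor {C : Type*} [Category* C] [HasTerminal C] [HasInitial C]
    (T : C ⥤ C ⥤ C)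
    [PreservesLimit (Functor.empty.{0} C) (T.obj (⊥_ C))]
    [PreservesColimit (Functor.empty.{0} C) (T.flip.obj (⊤_ C))] :
    HasZeroObject C := by
  have ht : IsTerminal ((T.obj (⊥_ C)).obj (⊤_ C)) :=
    isLimitOfHasTerminalOfPreservesLimit (T.obj (⊥_ C))
  have hi : IsInitial ((T.obj (⊥_ C)).obj (⊤_ C)) :=
    isColimitOfHasInitialOfPreservesColimit (T.flip.obj (⊤_ C))
  exact IsZero.hasZeroObject (X := (T.obj (⊥_ C)).obj (⊤_ C))
    { unique_to := fun Y => ⟨⟨⟨hi.to Y⟩, fun _ => hi.hom_ext _ _⟩⟩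
      unique_from := fun Y => ⟨⟨⟨ht.from Y⟩, fun _ => ht.hom_ext _ _⟩⟩ }

section RightUnit

variable {C : Type*} [Category* C] (T : C ⥤ C ⥤ C) {I : C}
  {J : Type*} [HasProduct fun _ : J => I]

/-- The projections `X ⊗ ∏ I ⟶ X ⊗ I ≅ X`. -/
noncomputable def rightUnitPowerπ (ru : T.flip.obj I ≅ 𝟭 C) (X : C) (j : J) :
    (T.obj X).obj (∏ᶜ fun _ : J => I) ⟶ X :=
  (T.obj X).map (Pi.π (fun _ : J => I) j) ≫ ru.hom.app X

theorem rightUnitPowerπ_naturality (ru : T.flip.obj I ≅ 𝟭 C) {X Y : C} (f : X ⟶ Y) (j : J) :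
    (T.map f).app (∏ᶜ fun _ : J => I) ≫ rightUnitPowerπ T ru Y j =
      rightUnitPowerπ T ru X j ≫ f := by
  have h := ru.hom.naturality f
  dsimp at h
  simp [rightUnitPowerπ, ← h]

/-- `X ⊗ ∏ I` is a power of `X` when `X ⊗ -` preserves the product. -/
noncomputable def isLimitRightUnitPower (ru : T.flip.obj I ≅ 𝟭 C) (X : C)
    [PreservesLimit (Discrete.functor fun _ : J => I) (T.obj X)] :
    IsLimit (Fan.mk ((T.obj X).obj (∏ᶜ fun _ : J => I)) (rightUnitPowerπ T ru X)) :=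
  have h := isLimitOfHasProductOfPreservesLimit (T.obj X) (fun _ : J => I)
  Fan.IsLimit.mk _ (fun s => Fan.IsLimit.lift h fun j => s.proj j ≫ ru.inv.app X)
    (fun s j => by
      have e := Fan.IsLimit.fac h (fun j => s.proj j ≫ ru.inv.app X) j
      dsimp at e
      simp [rightUnitPowerπ, reassoc_of% e])
    (fun s m hm => Fan.IsLimit.hom_ext h _ _ fun j => by
      rw [Fan.IsLimit.fac, ← hm j]
      simp [rightUnitPowerπ])

/-- A family indexed by `J` has a biproduct if `X ⊗ -` preserves `J`-indexed powers of the right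
unit and `- ⊗ Y` preserves the coproduct of the family. -/
theorem hasBiproduct_of_bifunctor_rightUnit [HasZeroMorphisms C]
    (ru : T.flip.obj I ≅ 𝟭 C)
    [∀ X : C, PreservesLimit (Discrete.functor fun _ : J => I) (T.obj X)]
    (A : J → C) [HasCoproduct A]
    [PreservesColimit (Discrete.functor A) (T.flip.obj (∏ᶜ fun _ : J => I))] :
    HasBiproduct A := by
  classical
  let q := rightUnitPowerπ T (J := J) ru
  have hq (X : C) : IsLimit (Fan.mk _ (q X)) := isLimitRightUnitPower T ru X
  have hP := isColimitOfHasCoproductOfPreservesColimit (T.flip.obj (∏ᶜ fun _ : J => I)) A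
  let π (j : J) : ∐ A ⟶ A j :=
    Sigma.desc fun i => if h : i = j then eqToHom (congrArg A h) else 0
  have ι_π (i j : J) : Sigma.ι A i ≫ π j =
      if h : i = j then eqToHom (congrArg A h) else 0 := by simp [π]
  let e : (T.obj (∐ A)).obj (∏ᶜ fun _ : J => I) ⟶ ∐ A :=
    Cofan.IsColimit.desc hP fun i => q (A i) i ≫ Sigma.ι A i
  have map_ι_e (i : J) : (T.map (Sigma.ι A i)).app (∏ᶜ fun _ : J => I) ≫ e =
      q (A i) i ≫ Sigma.ι A i :=
    Cofan.IsColimit.fac hP (fun i => q (A i) i ≫ Sigma.ι A i) i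
  have map_ι_q (i j : J) : (T.map (Sigma.ι A i)).app (∏ᶜ fun _ : J => I) ≫ q (∐ A) j =
      q (A i) j ≫ Sigma.ι A i := rightUnitPowerπ_naturality T ru _ j
  have e_π (j : J) : e ≫ π j = q (∐ A) j ≫ π j := by
    refine Cofan.IsColimit.hom_ext hP _ _ fun i => ?_
    change (T.map (Sigma.ι A i)).app _ ≫ _ = (T.map (Sigma.ι A i)).app _ ≫ _
    rw [reassoc_of% (map_ι_e i), reassoc_of% (map_ι_q i j), ι_π]
    by_cases h : i = j
    · subst h; rfl
    · simp [h]
  let u : ∐ A ⟶ (T.obj (∐ A)).obj (∏ᶜ fun _ : J => I) :=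
    Fan.IsLimit.lift (hq _) fun j => π j ≫ Sigma.ι A j
  have u_q (j : J) : u ≫ q _ j = π j ≫ Sigma.ι A j :=
    Fan.IsLimit.fac (hq (∐ A)) (fun j => π j ≫ Sigma.ι A j) j
  have u_e : u ≫ e = 𝟙 _ := by
    refine Sigma.hom_ext _ _ fun i => ?_
    let v : A i ⟶ (T.obj (A i)).obj (∏ᶜ fun _ : J => I) :=
      Fan.IsLimit.lift (hq _) fun j => if i = j then 𝟙 _ else 0
    have v_q (j : J) : v ≫ q _ j = if i = j then 𝟙 _ else 0 :=
      Fan.IsLimit.fac (hq (A i)) (fun j => if i = j then 𝟙 _ else 0) j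
    have ι_u : Sigma.ι A i ≫ u = v ≫ (T.map (Sigma.ι A i)).app _ := by
      refine Fan.IsLimit.hom_ext (hq _) _ _ fun j => ?_
      change (_ ≫ _) ≫ q _ j = (_ ≫ _) ≫ q _ j
      rw [Category.assoc, Category.assoc, u_q, map_ι_q, reassoc_of% (v_q j),
        reassoc_of% (ι_π i j)]
      by_cases h : i = j
      · subst h; simp
      · simp [h]
    rw [reassoc_of% ι_u, map_ι_e, reassoc_of% (v_q i)]
    simp
  let b : Bicone A := { pt := ∐ A, π := π, ι := Sigma.ι A, ι_π := ι_π }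
  refine HasBiproduct.mk ⟨b, ?_, ?_⟩
  · refine Fan.IsLimit.mk _
      (fun s => Fan.IsLimit.lift (hq (∐ A)) (fun j => s.proj j ≫ Sigma.ι A j) ≫ e)
      (fun s j => ?_) (fun s (m : s.pt ⟶ ∐ A) (hm : ∀ j, m ≫ π j = s.proj j) => ?_)
    · have fac := Fan.IsLimit.fac (hq (∐ A)) (fun j => s.proj j ≫ Sigma.ι A j) j
      change _ ≫ q _ j = _ at fac
      change (_ ≫ e) ≫ π j = _
      rw [Category.assoc, e_π, reassoc_of% fac, ι_π]
      simp
    · have m_u : m ≫ u = Fan.IsLimit.lift (hq (∐ A)) (fun j => s.proj j ≫ Sigma.ι A j) := by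
        refine Fan.IsLimit.hom_ext (hq _) _ _ fun j => ?_
        rw [Fan.IsLimit.fac, ← hm j]
        change (m ≫ u) ≫ q _ j = (m ≫ π j) ≫ _
        rw [Category.assoc, Category.assoc, u_q]
      rw [← m_u]
      change m = (m ≫ u) ≫ e
      rw [Category.assoc, u_e, Category.comp_id]
  · exact coproductIsCoproduct A

end RightUnit

end CategoryTheory.Limits

/-- Let `C` have finite products and coproducts, and let `T : C ⥤ C ⥤ C` be a
bifunctor with a right unit `I` (a natural isomorphism `- ⊗ I ≅ 𝟭 C`; no
associativity or left unit is assumed), such that every `A ⊗ - = T.obj A`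
preserves finite products and every `- ⊗ A = T.flip.obj A` preserves finite
coproducts. Then `C` has finite biproducts. -/
theorem bifunctor_rightUnit_distrib_hasFiniteBiproducts
    {C : Type u} [Category.{v} C]
    [HasFiniteProducts C] [HasFiniteCoproducts C]
    (T : C ⥤ C ⥤ C) (I : C) (ru : T.flip.obj I ≅ 𝟭 C)
    [∀ A : C, PreservesFiniteProducts (T.obj A)]
    [∀ A : C, PreservesFiniteCoproducts (T.flip.obj A)] :
    ∃ _ : HasZeroMorphisms C, HasFiniteBiproducts C := by
  have := hasZeroObject_of_bifunctor T
  let := HasZeroObject.zeroMorphismsOfZeroObject (C := C)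
  exact ⟨inferInstance, ⟨fun _ => ⟨fun A => hasBiproduct_of_bifunctor_rightUnit T ru A⟩⟩⟩
end
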